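/- Let 0 < p < ∞, 0 < s < 2/p and 1/τ = s/2 + 1/p. There exists a constant c > 0, depending only on s, p and the structural parameters N₀, c₀, β, such that for every n ≥ n₀ and every S ∈ S(n,1) one has the Bernstein estimate |S|_{B^{s,1}_τ} ≤ c · n^{s/2} · ‖S‖_{L^p(Ω)}. -/

import Mathlib

open scoped Classical

open Set Metric MeasureTheory ENNReal

noncomputable section

/-- The Euclidean plane `ℝ²`. -/
abbrev Plane : Type := EuclideanSpace ℝ (Fin 2)

/-- `Q` is a compact regular convex set whose boundary is a polygon consisting of at most
`N₀` line segments, with eccentricity bounded by `c₀`. -/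
def IsRegularConvexPolygon (N₀ : ℕ) (c₀ : ℝ) (Q : Set Plane) : Prop :=
  IsCompact Q ∧ Convex ℝ Q ∧ Q.Nonempty ∧
    (∃ (m : ℕ) (v w : Fin m → Plane), m ≤ N₀ ∧ frontier Q = ⋃ i, segment ℝ (v i) (w i)) ∧
    (∃ (x₁ x₂ : Plane) (r₁ r₂ : ℝ), 0 < r₂ ∧
      closedBall x₂ r₂ ⊆ Q ∧ Q ⊆ closedBall x₁ r₁ ∧ r₁ ≤ c₀ * r₂)

/-- There is a triangle contained in `R` having the segment `[a,b]` as a side, whose two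
angles adjacent to that side are equal to `β`. -/
def HasGoodTriangle (β : ℝ) (R : Set Plane) (a b : Plane) : Prop :=
  ∃ c : Plane, convexHull ℝ {a, b, c} ⊆ R ∧
    EuclideanGeometry.angle b a c = β ∧ EuclideanGeometry.angle a b c = β

/-- `R ⊆ ℝ²` is a ring with structural parameters `N₀`, `c₀`, `β`: the difference of two
regular compact convex sets with polygonal boundaries, admitting no uncontrollably narrow
elongated subregions (each maximal edge of the boundary can be subdivided into at most two
segments, each carrying a good triangle with adjacent angles `β` inside `R`). -/
def IsRing (N₀ : ℕ) (c₀ β : ℝ) (R : Set Plane) : Prop :=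
  (∃ Q₁ Q₂ : Set Plane,
      IsRegularConvexPolygon N₀ c₀ Q₁ ∧
      (Q₂ = ∅ ∨ (Q₂ ⊆ Q₁ ∧ IsRegularConvexPolygon N₀ c₀ Q₂)) ∧
      R = Q₁ \ interior Q₂) ∧
  (∃ (m : ℕ) (v w : Fin m → Plane),
      frontier R = ⋃ i, segment ℝ (v i) (w i) ∧
      (∀ i, ∀ a b : Plane, segment ℝ (v i) (w i) ⊆ segment ℝ a b →
        segment ℝ a b ⊆ frontier R → segment ℝ a b = segment ℝ (v i) (w i)) ∧
      (∀ i, ∃ p ∈ segment ℝ (v i) (w i),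
        HasGoodTriangle β R (v i) p ∧ HasGoodTriangle β R p (w i)))

/-- `Ω` is the union of `n` rings with pairwise disjoint interiors. -/
def IsRingDecomp (N₀ : ℕ) (c₀ β : ℝ) (n : ℕ) (Ω : Set Plane) : Prop :=
  ∃ R : Fin n → Set Plane,
    (∀ j, IsRing N₀ c₀ β (R j)) ∧
    (∀ i j, i ≠ j → interior (R i) ∩ interior (R j) = ∅) ∧
    (⋃ j, R j) = Ω

/-- Membership in the nonlinear spline class `S(n,k)`: piecewise polynomials of total degree
`< k` over `n` rings with pairwise disjoint interiors whose union is `Ω` (or, when `Ω = ℝ²`,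
whose union -- the support of the spline -- is itself a ring), having maximum smoothness
`W^{k-2}(Ω)` when `k ≥ 2` (no smoothness is required for piecewise constants, `k = 1`). -/
def IsSpline (N₀ : ℕ) (c₀ β : ℝ) (n k : ℕ) (Ω : Set Plane) (S : Plane → ℝ) : Prop :=
  ∃ (R : Fin n → Set Plane) (P : Fin n → MvPolynomial (Fin 2) ℝ),
    (∀ j, IsRing N₀ c₀ β (R j)) ∧
    (∀ i j, i ≠ j → interior (R i) ∩ interior (R j) = ∅) ∧
    ((⋃ j, R j) = Ω ∨ (Ω = Set.univ ∧ IsRing N₀ c₀ β (⋃ j, R j))) ∧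
    (∀ j, (P j).totalDegree < k) ∧
    (S = fun x => ∑ j, (R j).indicator (fun y => MvPolynomial.eval (fun i => y i) (P j)) x) ∧
    (2 ≤ k → ContDiffOn ℝ ((k - 2 : ℕ) : ℕ∞) S Ω)

/-- The spline class `S(n,k,r)` with defect: smoothness `W^r(Ω)` instead of the maximal
smoothness `W^{k-2}(Ω)`. -/
def IsSplineDefect (N₀ : ℕ) (c₀ β : ℝ) (n k r : ℕ) (Ω : Set Plane) (S : Plane → ℝ) : Prop :=
  ∃ (R : Fin n → Set Plane) (P : Fin n → MvPolynomial (Fin 2) ℝ),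
    (∀ j, IsRing N₀ c₀ β (R j)) ∧
    (∀ i j, i ≠ j → interior (R i) ∩ interior (R j) = ∅) ∧
    ((⋃ j, R j) = Ω ∨ (Ω = Set.univ ∧ IsRing N₀ c₀ β (⋃ j, R j))) ∧
    (∀ j, (P j).totalDegree < k) ∧
    (S = fun x => ∑ j, (R j).indicator (fun y => MvPolynomial.eval (fun i => y i) (P j)) x) ∧
    ContDiffOn ℝ ((r : ℕ) : ℕ∞) S Ω

/-- The `L^p(Ω)` quasi-norm, `0 < p < ∞`. -/
def lpNormE (p : ℝ) (Ω : Set Plane) (f : Plane → ℝ) : ℝ≥0∞ :=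
  eLpNorm f (ENNReal.ofReal p) (volume.restrict Ω)

/-- `k`-th finite difference `Δ_h^k f(x)`, set to `0` unless the segment `[x, x+kh] ⊆ Ω`. -/
def deltah (Ω : Set Plane) (k : ℕ) (h : Plane) (f : Plane → ℝ) (x : Plane) : ℝ :=
  if segment ℝ x (x + (k : ℝ) • h) ⊆ Ω then
    ∑ ν ∈ Finset.range (k + 1), (-1 : ℝ) ^ (k + ν) * (k.choose ν : ℝ) * f (x + (ν : ℝ) • h)
  else 0

/-- Modulus of smoothness `ω_k(f,t)_τ = sup_{|h| ≤ t} ‖Δ_h^k f‖_{L^τ(Ω)}`. -/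
def modulus (Ω : Set Plane) (k : ℕ) (τ : ℝ) (f : Plane → ℝ) (t : ℝ) : ℝ≥0∞ :=
  ⨆ (h : Plane) (_ : ‖h‖ ≤ t), lpNormE τ Ω (deltah Ω k h f)

/-- Besov seminorm `|f|_{B^{s,k}_τ} = (∫₀^∞ [t^{-s} ω_k(f,t)_τ]^τ dt/t)^{1/τ}`. -/
def besovSeminorm (Ω : Set Plane) (k : ℕ) (s τ : ℝ) (f : Plane → ℝ) : ℝ≥0∞ :=
  (∫⁻ t in Set.Ioi (0 : ℝ),
      (ENNReal.ofReal (t ^ (-s)) * modulus Ω k τ f t) ^ τ / ENNReal.ofReal t) ^ (1 / τ)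

/-- Error of best `L^p(Ω)`-approximation `S_n^k(f)_p` from the spline class `S(n,k)`. -/
def splineApprox (N₀ : ℕ) (c₀ β : ℝ) (n k : ℕ) (p : ℝ) (Ω : Set Plane) (f : Plane → ℝ) :
    ℝ≥0∞ :=
  ⨅ (S : Plane → ℝ) (_ : IsSpline N₀ c₀ β n k Ω S), lpNormE p Ω fun x => f x - S x

/-- The K-functional `K(f,t; L^p(Ω), B^{s,k}_τ)`. -/
def kFunctional (Ω : Set Plane) (k : ℕ) (s τ p : ℝ) (f : Plane → ℝ) (t : ℝ) : ℝ≥0∞ :=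
  ⨅ g : Plane → ℝ,
    lpNormE p Ω (fun x => f x - g x) + ENNReal.ofReal t * besovSeminorm Ω k s τ g

/-- BV seminorm: the total mass of the distributional gradient of `g` on `Ω`, defined by
duality against compactly supported `C¹` vector fields of norm at most one. -/
def bvSeminorm (Ω : Set Plane) (g : Plane → ℝ) : ℝ≥0∞ :=
  ⨆ (φ : Plane → Plane) (_ : ContDiff ℝ 1 φ ∧ HasCompactSupport φ ∧
      tsupport φ ⊆ interior Ω ∧ ∀ x, ‖φ x‖ ≤ 1),
    ENNReal.ofReal (∫ x in Ω, g x * ∑ i, fderiv ℝ φ x (EuclideanSpace.single i 1) i)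

/-- The K-functional `K(f,t; L²(Ω), BV(Ω))`. -/
def kFunctionalBV (Ω : Set Plane) (f : Plane → ℝ) (t : ℝ) : ℝ≥0∞ :=
  ⨅ g : Plane → ℝ,
    lpNormE 2 Ω (fun x => f x - g x) + ENNReal.ofReal t * bvSeminorm Ω g

lemma volume_le_of_subset_closedBall {K : Set Plane} {x : Plane} {R : ℝ} (hR : 0 ≤ R)
    (hB : K ⊆ closedBall x R) : volume K ≤ ENNReal.ofReal (Real.pi * R ^ 2) := by
  refine (measure_mono hB).trans (le_of_eq ?_)
  rw [EuclideanSpace.volume_closedBall_fin_two, mul_comm Real.pi,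
    ENNReal.ofReal_mul (by positivity), ENNReal.ofReal_pow hR]

/-- Translating a convex set of controlled eccentricity by `h` moves out of the set at most a
portion of measure proportional to `‖h‖`. -/
lemma volume_diff_preimage_add_le {K : Set Plane} (hK : Convex ℝ K) {x₁ x₂ : Plane} {r R : ℝ}
    (hr : 0 < r) (hR : 0 ≤ R) (hb : ball x₂ r ⊆ K) (hB : K ⊆ closedBall x₁ R) (h : Plane) :
    volume (K \ ((· + h) ⁻¹' K)) ≤ ENNReal.ofReal (4 * Real.pi * R ^ 2 * ‖h‖ / r) := by
  have hvol := volume_le_of_subset_closedBall hR hB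
  have hfin : volume K ≠ ∞ := ne_top_of_le_ne_top ENNReal.ofReal_ne_top hvol
  have hreal : volume.real K ≤ Real.pi * R ^ 2 :=
    ENNReal.toReal_le_of_le_ofReal (by positivity) hvol
  by_cases hh : r ≤ 2 * ‖h‖
  · refine (measure_mono sdiff_subset).trans (hvol.trans (ENNReal.ofReal_le_ofReal ?_))
    rw [le_div_iff₀ hr]
    have : 0 ≤ Real.pi * R ^ 2 := by positivity
    nlinarith [norm_nonneg h]
  push Not at hh
  set l : ℝ := 2 * ‖h‖ / r with hl
  have hl0 : 0 ≤ l := by positivity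
  have hl1 : l < 1 := by rw [hl, div_lt_one hr]; exact hh
  have hx₂ : x₂ ∈ K := hb (mem_ball_self hr)
  set L : Set Plane := AffineMap.homothety x₂ (1 - l) '' K with hLdef
  have hLK : L ⊆ K := by
    rintro _ ⟨k, hk, rfl⟩
    rw [AffineMap.homothety_apply]
    have := hK hk hx₂ (by linarith : 0 ≤ 1 - l) hl0 (by ring)
    convert this using 1
    simp only [vsub_eq_sub, vadd_eq_add]; module
  have hLh : L ⊆ (· + h) ⁻¹' K := by
    rintro _ ⟨k, hk, rfl⟩
    rcases eq_or_ne h 0 with rfl | hne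
    · simpa using hLK ⟨k, hk, rfl⟩
    have hhpos : 0 < ‖h‖ := norm_pos_iff.mpr hne
    have hlpos : 0 < l := by positivity
    have hy : x₂ + l⁻¹ • h ∈ K := by
      apply hb
      rw [mem_ball, dist_self_add_left, norm_smul, Real.norm_eq_abs, abs_of_pos (by positivity), hl]
      field_simp
      linarith
    have := hK hk hy (by linarith : 0 ≤ 1 - l) hl0 (by ring)
    rw [mem_preimage, AffineMap.homothety_apply]
    convert this using 1
    simp only [vsub_eq_sub, vadd_eq_add, smul_add, smul_smul, mul_inv_cancel₀ hlpos.ne']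
    module
  have hLconv : Convex ℝ L := hK.affine_image _
  have hLvol : volume.real L = (1 - l) ^ 2 * volume.real K := by
    rw [measureReal_def, hLdef, Measure.addHaar_image_homothety, ENNReal.toReal_mul,
      ENNReal.toReal_ofReal (abs_nonneg _)]
    simp [measureReal_def]
  have hdiff : volume.real (K \ L) ≤ 2 * l * volume.real K := by
    have h1 : volume (K \ L) = volume K - volume L :=
      measure_sdiff hLK (hLconv.nullMeasurableSet volume) (ne_top_of_le_ne_top hfin (measure_mono hLK))
    have h2 : volume.real (K \ L) = volume.real K - volume.real L := by
      rw [measureReal_def, h1, ENNReal.toReal_sub_of_le (measure_mono hLK) hfin]; rfl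
    rw [h2, hLvol]
    have : 0 ≤ volume.real K := measureReal_nonneg
    nlinarith [mul_nonneg (sq_nonneg l) this]
  have hfin' : volume (K \ L) ≠ ∞ := ne_top_of_le_ne_top hfin (measure_mono sdiff_subset)
  calc volume (K \ ((· + h) ⁻¹' K)) ≤ volume (K \ L) := measure_mono (sdiff_subset_sdiff_right hLh)
    _ = ENNReal.ofReal (volume.real (K \ L)) := (ENNReal.ofReal_toReal hfin').symm
    _ ≤ ENNReal.ofReal (4 * Real.pi * R ^ 2 * ‖h‖ / r) := by
        refine ENNReal.ofReal_le_ofReal (hdiff.trans ?_)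
        calc 2 * l * volume.real K ≤ 2 * l * (Real.pi * R ^ 2) := by gcongr
          _ = _ := by rw [hl]; ring

/-- The points whose membership in `K` changes under translation by `h`. -/
def shiftDiff (K : Set Plane) (h : Plane) : Set Plane := {x | ¬ (x ∈ K ↔ x + h ∈ K)}

lemma measurableSet_shiftDiff {K : Set Plane} (hK : MeasurableSet K) (h : Plane) :
    MeasurableSet (shiftDiff K h) := by
  have : shiftDiff K h = symmDiff K ((· + h) ⁻¹' K) := by
    ext x
    simp only [shiftDiff, mem_ofPred_eq, mem_symmDiff, mem_preimage]
    tauto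
  rw [this]
  exact hK.symmDiff (hK.preimage (measurable_add_const h))

lemma volume_shiftDiff_le_add {K : Set Plane} (h : Plane) :
    volume (shiftDiff K h) ≤
      volume (K \ ((· + h) ⁻¹' K)) + volume (K \ ((· + -h) ⁻¹' K)) := by
  have : shiftDiff K h ⊆
      (K \ ((· + h) ⁻¹' K)) ∪ ((· + h) ⁻¹' (K \ ((· + -h) ⁻¹' K))) := by
    intro x hx
    simp only [shiftDiff, mem_ofPred_eq] at hx
    simp only [mem_union, mem_sdiff, mem_preimage, add_neg_cancel_right]
    tauto
  refine (measure_mono this).trans ((measure_union_le _ _).trans ?_)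
  rw [measure_preimage_add_right]

lemma volume_shiftDiff_le {K : Set Plane} (hK : Convex ℝ K) {x₁ x₂ : Plane} {r R : ℝ}
    (hr : 0 < r) (hR : 0 ≤ R) (hb : ball x₂ r ⊆ K) (hB : K ⊆ closedBall x₁ R) (h : Plane) :
    volume (shiftDiff K h) ≤ ENNReal.ofReal (8 * Real.pi * R ^ 2 * ‖h‖ / r) := by
  refine (volume_shiftDiff_le_add h).trans ((add_le_add
    (volume_diff_preimage_add_le hK hr hR hb hB h)
    (volume_diff_preimage_add_le hK hr hR hb hB (-h))).trans (le_of_eq ?_))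
  rw [norm_neg, ← ENNReal.ofReal_add (by positivity) (by positivity)]
  congr 1; ring

lemma volume_shiftDiff_le_two_mul (K : Set Plane) (h : Plane) :
    volume (shiftDiff K h) ≤ 2 * volume K := by
  refine (volume_shiftDiff_le_add h).trans ?_
  rw [two_mul]
  exact add_le_add (measure_mono sdiff_subset) (measure_mono sdiff_subset)

/-- If finitely many segments cover the boundary of a bounded set containing a ball of radius `r`,
then their total length is at least `2 * r`. -/
lemma two_mul_le_sum_dist_of_frontier {Q : Set Plane} {x₁ x₂ : Plane} {r R : ℝ}
    (hb : closedBall x₂ r ⊆ Q) (hB : Q ⊆ closedBall x₁ R) {m : ℕ} (v w : Fin m → Plane)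
    (hf : frontier Q ⊆ ⋃ i, segment ℝ (v i) (w i)) :
    2 * r ≤ ∑ i, dist (v i) (w i) := by
  have coord (a b : Plane) (i : Fin 2) : |a i - b i| ≤ dist a b := by
    rw [dist_eq_norm, ← Real.norm_eq_abs]
    exact PiLp.norm_apply_le (a - b) i
  have hcover : Icc (x₂ 0 - r) (x₂ 0 + r) ⊆ ⋃ i, uIcc (v i 0) (w i 0) := by
    intro y hy
    set A : Set Plane := {z | z 0 = y} with hA
    have hAc : Convex ℝ A := by
      intro a ha b hb s t _ _ hst
      simp only [hA, mem_ofPred_eq] at ha hb ⊢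
      simp [ha, hb, ← add_mul, hst]
    have h1 : (A ∩ Q).Nonempty := by
      refine ⟨!₂[y, x₂ 1], by simp [hA], hb ?_⟩
      rw [mem_closedBall, EuclideanSpace.dist_eq]
      simp only [Fin.sum_univ_two, Matrix.cons_val_zero, Matrix.cons_val_one,
        dist_self]
      rw [show dist y (x₂ 0) ^ 2 + 0 ^ 2 = dist y (x₂ 0) ^ 2 by ring, Real.sqrt_sq dist_nonneg,
        Real.dist_eq, abs_le]
      constructor <;> linarith [hy.1, hy.2]
    have h2 : (A ∩ Qᶜ).Nonempty := by
      refine ⟨!₂[y, x₁ 1 + R + 1], by simp [hA], fun hq => ?_⟩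
      have := (coord _ _ 1).trans (mem_closedBall.mp (hB hq))
      simp only [Matrix.cons_val_one, Matrix.cons_val_zero] at this
      linarith [le_abs_self (x₁ 1 + R + 1 - x₁ 1)]
    obtain ⟨z, hzA, hzf⟩ : (A ∩ frontier Q).Nonempty := by
      by_contra hcon
      have hno (z) (hz : z ∈ A) : z ∉ frontier Q := fun hzf => hcon ⟨z, hz, hzf⟩
      obtain ⟨z, -, hz1, hz2⟩ := hAc.isPreconnected (interior Q) (closure Q)ᶜ isOpen_interior
        isClosed_closure.isOpen_compl
        (fun z hz => by
          by_contra h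
          simp only [mem_union, mem_compl_iff, not_or, not_not] at h
          exact hno z hz ⟨h.2, h.1⟩)
        (h1.imp fun z hz => ⟨hz.1, by_contra fun h => hno z hz.1 ⟨subset_closure hz.2, h⟩⟩)
        (h2.imp fun z hz => ⟨hz.1, fun h => hno z hz.1 ⟨h, fun h' => hz.2 (interior_subset h')⟩⟩)
      exact hz2 (subset_closure (interior_subset hz1))
    obtain ⟨i, hi⟩ := mem_iUnion.mp (hf hzf)
    refine mem_iUnion.mpr ⟨i, ?_⟩
    rw [← segment_eq_uIcc, ← show z 0 = y from hzA]
    have := mem_image_of_mem (EuclideanSpace.proj (𝕜 := ℝ) (0 : Fin 2) : Plane →L[ℝ] ℝ) hi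
    have h3 := image_segment ℝ
      (EuclideanSpace.proj (𝕜 := ℝ) (0 : Fin 2) : Plane →L[ℝ] ℝ).toLinearMap.toAffineMap (v i) (w i)
    rw [← show _ = segment ℝ (v i 0) (w i 0) from h3]
    exact this
  have := (measure_mono hcover (μ := volume)).trans (measure_iUnion_le _)
  simp only [Real.volume_Icc, tsum_fintype, Real.volume_interval] at this
  rw [← ENNReal.ofReal_sum_of_nonneg (fun _ _ => abs_nonneg _),
    ENNReal.ofReal_le_ofReal_iff (Finset.sum_nonneg fun _ _ => abs_nonneg _)] at this
  calc 2 * r = x₂ 0 + r - (x₂ 0 - r) := by ring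
    _ ≤ _ := this
    _ ≤ _ := Finset.sum_le_sum fun i _ => by rw [dist_comm]; exact coord _ _ 0

/-- A segment with two distinct points is an interval on the line through them. -/
lemma exists_segment_eq_image_lineMap {E : Type*} [AddCommGroup E] [Module ℝ E] {a b p q : E}
    (hp : p ∈ segment ℝ a b) (hq : q ∈ segment ℝ a b) (hpq : p ≠ q) :
    ∃ s t : ℝ, segment ℝ a b = AffineMap.lineMap p q '' Icc s t := by
  rw [segment_eq_image_lineMap] at hp hq
  obtain ⟨x, -, rfl⟩ := hp
  obtain ⟨y, -, rfl⟩ := hq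
  have hxy : y - x ≠ 0 := fun h => hpq (by rw [sub_eq_zero.mp h])
  set p := AffineMap.lineMap a b x with hp
  set q := AffineMap.lineMap a b y with hq
  have key (u : ℝ) : AffineMap.lineMap a b u = AffineMap.lineMap p q ((u - x) / (y - x)) := by
    rw [hp, hq]
    simp only [AffineMap.lineMap_apply_module']
    rw [show ∀ (s : ℝ), s • (y • (b - a) + a - (x • (b - a) + a)) + (x • (b - a) + a)
      = (s * (y - x) + x) • (b - a) + a from fun s => by module, div_mul_cancel₀ _ hxy]
    congr 2; ring
  have h0 := key 0
  have h1 := key 1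
  rw [AffineMap.lineMap_apply_zero] at h0
  rw [AffineMap.lineMap_apply_one] at h1
  refine ⟨min ((0 - x) / (y - x)) ((1 - x) / (y - x)),
    max ((0 - x) / (y - x)) ((1 - x) / (y - x)), ?_⟩
  rw [← uIcc, ← segment_eq_uIcc, image_segment, ← h0, ← h1]

/-- A nondegenerate segment covered by finitely many segments, each of which is maximal within
their union, lies in one of them. -/
lemma exists_segment_subset_of_maximal {E : Type*} [AddCommGroup E] [Module ℝ E]
    {F : Set E} {m : ℕ} {v w : Fin m → E}
    (hF : F = ⋃ i, segment ℝ (v i) (w i))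
    (hmax : ∀ i, ∀ a b : E, segment ℝ (v i) (w i) ⊆ segment ℝ a b →
        segment ℝ a b ⊆ F → segment ℝ a b = segment ℝ (v i) (w i))
    {a b : E} (hab : a ≠ b) (habF : segment ℝ a b ⊆ F) :
    ∃ i, segment ℝ a b ⊆ segment ℝ (v i) (w i) := by
  have hinf : (segment ℝ a b).Infinite := by
    rw [segment_eq_image_lineMap]
    exact (Icc_infinite zero_lt_one).image (AffineMap.lineMap_injective ℝ hab).injOn
  have : ∃ i, (segment ℝ a b ∩ segment ℝ (v i) (w i)).Nontrivial := by
    by_contra! hcon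
    refine hinf ?_
    rw [← inter_eq_left.mpr habF, hF, inter_iUnion]
    exact finite_iUnion fun i => (hcon i).finite
  obtain ⟨i, p, hp, q, hq, hpq⟩ := this
  refine ⟨i, ?_⟩
  obtain ⟨s, t, hst⟩ := exists_segment_eq_image_lineMap hp.1 hq.1 hpq
  obtain ⟨s', t', hst'⟩ := exists_segment_eq_image_lineMap hp.2 hq.2 hpq
  have hinj := AffineMap.lineMap_injective ℝ hpq
  have h0 : (0 : ℝ) ∈ Icc s t := by
    rw [← hinj.mem_set_image, ← hst, AffineMap.lineMap_apply_zero]; exact hp.1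
  have h0' : (0 : ℝ) ∈ Icc s' t' := by
    rw [← hinj.mem_set_image, ← hst', AffineMap.lineMap_apply_zero]; exact hp.2
  have hunion : Icc s t ∪ Icc s' t' = Icc (min s s') (max t t') :=
    Icc_union_Icc' (h0'.1.trans h0.2) (h0.1.trans h0'.2)
  set x := min s s'
  set y := max t t'
  have hxy : x ≤ y := (min_le_left _ _).trans (h0.1.trans (h0.2.trans (le_max_left _ _)))
  have hseg : segment ℝ (AffineMap.lineMap p q x) (AffineMap.lineMap p q y)
      = segment ℝ a b ∪ segment ℝ (v i) (w i) := by
    rw [← image_segment, segment_eq_Icc hxy, ← hunion, image_union, ← hst, ← hst']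
  have := hmax i _ _ (hseg ▸ subset_union_right) (by
    rw [hseg]
    exact union_subset habF (hF ▸ subset_iUnion (fun i => segment ℝ (v i) (w i)) i))
  rw [← this, hseg]
  exact subset_union_left

/-- The standard triangle with vertices `0`, `e₁`, `e₂`. -/
def stdTriangle : Set Plane := {x | 0 ≤ x 0 ∧ 0 ≤ x 1 ∧ x 0 + x 1 ≤ 1}

lemma volume_stdTriangle_pos : 0 < volume stdTriangle := by
  have hopen : IsOpen {x : Plane | 0 < x 0 ∧ 0 < x 1 ∧ x 0 + x 1 < 1} :=
    (isOpen_lt (f := fun _ : Plane => (0 : ℝ)) (g := fun x => x 0) (by fun_prop) (by fun_prop)).inter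
      ((isOpen_lt (f := fun _ : Plane => (0 : ℝ)) (g := fun x => x 1) (by fun_prop)
        (by fun_prop)).inter
        (isOpen_lt (f := fun x : Plane => x 0 + x 1) (g := fun _ => (1 : ℝ)) (by fun_prop)
          (by fun_prop)))
  refine (hopen.measure_pos volume ⟨!₂[1 / 4, 1 / 4], ?_⟩).trans_le
    (measure_mono fun x hx => ⟨hx.1.le, hx.2.1.le, hx.2.2.le⟩)
  simp only [mem_ofPred_eq, Matrix.cons_val_zero, Matrix.cons_val_one]
  norm_num

lemma volume_stdTriangle_ne_top : volume stdTriangle ≠ ∞ := by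
  refine ne_top_of_le_ne_top (measure_closedBall_lt_top (x := (0 : Plane)) (r := 2)).ne
    (measure_mono fun x hx => ?_)
  obtain ⟨h0, h1, h2⟩ := hx
  rw [mem_closedBall_zero_iff, EuclideanSpace.norm_eq, Real.sqrt_le_left (by norm_num)]
  simp only [Fin.sum_univ_two, Real.norm_eq_abs, sq_abs]
  nlinarith

lemma volume_convexHull_triangle (a b c : Plane) :
    ENNReal.ofReal |(b - a) 0 * (c - a) 1 - (b - a) 1 * (c - a) 0| * volume stdTriangle ≤
      volume (convexHull ℝ {a, b, c}) := by
  set f : Plane →ₗ[ℝ] Plane := Matrix.toLin (EuclideanSpace.basisFun (Fin 2) ℝ).toBasis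
    (EuclideanSpace.basisFun (Fin 2) ℝ).toBasis
    !![(b - a) 0, (c - a) 0; (b - a) 1, (c - a) 1] with hf
  have hdet : LinearMap.det f = (b - a) 0 * (c - a) 1 - (b - a) 1 * (c - a) 0 := by
    rw [hf, LinearMap.det_toLin, Matrix.det_fin_two_of]; ring
  have hfx (x : Plane) : f x = x 0 • (b - a) + x 1 • (c - a) := by
    rw [hf, Matrix.toLin_apply]
    ext i
    fin_cases i <;> simp [Matrix.mulVec, dotProduct, mul_comm]
  rw [← hdet, ← Measure.addHaar_image_linearMap]
  refine (measure_mono ?_).trans_eq (measure_preimage_add volume a _)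
  rintro _ ⟨x, ⟨h0, h1, h2⟩, rfl⟩
  have hmem := (convex_convexHull ℝ {a, b, c}).sum_mem (t := Finset.univ)
    (w := ![1 - x 0 - x 1, x 0, x 1]) (z := ![a, b, c])
    (by intro i _; fin_cases i <;> simp <;> linarith)
    (by simp only [Fin.sum_univ_three, Matrix.cons_val]; ring)
    (by intro i _; apply subset_convexHull; fin_cases i <;> simp)
  rw [mem_preimage, hfx]
  convert hmem using 1
  simp only [Fin.sum_univ_three, Matrix.cons_val]
  module

lemma volume_ge_of_hasGoodTriangle {β : ℝ} (hβ : 0 < β) (hβ' : β ≤ Real.pi / 3) {R : Set Plane}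
    {a b : Plane} (h : HasGoodTriangle β R a b) :
    ENNReal.ofReal (dist a b ^ 2 * Real.sin β / 2) * volume stdTriangle ≤ volume R := by
  obtain ⟨c, hR, ha, hb⟩ := h
  refine le_trans (mul_le_mul_left ?_ _) ((volume_convexHull_triangle a b c).trans (measure_mono hR))
  refine ENNReal.ofReal_le_ofReal ?_
  have hsin : 0 ≤ Real.sin β := Real.sin_nonneg_of_nonneg_of_le_pi hβ.le (by linarith [Real.pi_pos])
  have hcos0 : 0 ≤ Real.cos β :=
    Real.cos_nonneg_of_neg_pi_div_two_le_of_le (by linarith [Real.pi_pos]) (by linarith [Real.pi_pos])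
  have hne : a ≠ b := by
    rintro rfl
    rw [EuclideanGeometry.angle_self_left] at ha
    linarith [Real.pi_pos]
  have hnorm : ‖c - a‖ = ‖c - b‖ := by
    rw [← dist_eq_norm, ← dist_eq_norm]
    refine EuclideanGeometry.dist_eq_of_angle_eq_angle_of_angle_ne_pi ?_ fun hpi => ?_
    · rw [EuclideanGeometry.angle_comm c a b, EuclideanGeometry.angle_comm c b a, ha, hb]
    · have := EuclideanGeometry.angle_eq_zero_of_angle_eq_pi_left hpi
      rw [EuclideanGeometry.angle_comm, ha] at this
      exact hβ.ne' this
  have hinner : inner ℝ (b - a) (c - a) = ‖b - a‖ * ‖c - a‖ * Real.cos β := by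
    rw [← ha, EuclideanGeometry.angle, vsub_eq_sub, vsub_eq_sub,
      ← InnerProductGeometry.cos_angle_mul_norm_mul_norm]
    ring
  have hca : ‖b - a‖ ≤ 2 * ‖c - a‖ := by
    calc ‖b - a‖ = ‖(c - a) - (c - b)‖ := by congr 1; abel
      _ ≤ ‖c - a‖ + ‖c - b‖ := norm_sub_le _ _
      _ = _ := by rw [← hnorm]; ring
  have hsq : ((b - a) 0 * (c - a) 1 - (b - a) 1 * (c - a) 0) ^ 2
      = (‖b - a‖ * ‖c - a‖ * Real.sin β) ^ 2 := by
    have h1 : inner ℝ (b - a) (c - a) = (b - a) 0 * (c - a) 0 + (b - a) 1 * (c - a) 1 := by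
      rw [PiLp.inner_apply, Fin.sum_univ_two]; simp [mul_comm]
    have h2 (x : Plane) : ‖x‖ ^ 2 = x 0 ^ 2 + x 1 ^ 2 := by
      rw [EuclideanSpace.norm_sq_eq, Fin.sum_univ_two]; simp
    have h3 : (‖b - a‖ * ‖c - a‖ * Real.sin β) ^ 2
        = ‖b - a‖ ^ 2 * ‖c - a‖ ^ 2 - (inner ℝ (b - a) (c - a)) ^ 2 := by
      rw [hinner, mul_pow, Real.sin_sq]; ring
    rw [h3, h2, h2, h1]; ring
  rw [← Real.sqrt_sq_eq_abs, hsq, Real.sqrt_sq (by positivity), dist_comm, dist_eq_norm]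
  nlinarith [mul_nonneg (mul_nonneg (norm_nonneg (b - a)) hsin) (sub_nonneg.mpr hca)]

lemma frontier_subset_frontier_diff_interior {X : Type*} [TopologicalSpace X] {P Q : Set X}
    (hP : IsClosed P) (hQP : Q ⊆ P) : frontier P ⊆ frontier (P \ interior Q) := by
  rintro x ⟨hx, hx'⟩
  rw [hP.closure_eq] at hx
  exact ⟨subset_closure ⟨hx, fun h => hx' (interior_mono hQP h)⟩,
    fun h => hx' (interior_mono sdiff_subset h)⟩

/-- The measure-theoretic properties of a ring used in the Bernstein estimate. -/
lemma IsRing.exists_radius {N₀ : ℕ} {c₀ β : ℝ} (hc₀ : 1 ≤ c₀) (hβ : 0 < β)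
    (hβ' : β ≤ Real.pi / 3) {R : Set Plane} (hR : IsRing N₀ c₀ β R) :
    MeasurableSet R ∧ volume (frontier R) = 0 ∧ ∃ r : ℝ, 0 < r ∧
      (∀ h : Plane, volume (shiftDiff R h) ≤
        ENNReal.ofReal (16 * Real.pi * c₀ ^ 3 * min (‖h‖ * r) (r ^ 2))) ∧
      ENNReal.ofReal (r ^ 2 * (Real.sin β / (2 * (N₀ + 1) ^ 2))) * volume stdTriangle
        ≤ volume R := by
  obtain ⟨⟨Q₁, Q₂, ⟨hQc, hQconv, -, ⟨m, v, w, hm, hfr⟩, x₁, x₂, r₁, r, hr, hbQ, hQB, hr₁⟩,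
    hQ₂, rfl⟩, k, a, b, hfrR, hmax, htri⟩ := hR
  have hsub : Q₂ ⊆ Q₁ := by
    rcases hQ₂ with h | h
    · simp [h]
    · exact h.1
  have hconv₂ : Convex ℝ Q₂ := by
    rcases hQ₂ with h | h
    · simp [h, convex_empty]
    · exact h.2.2.1
  have hQB' : Q₁ ⊆ closedBall x₁ (c₀ * r) := hQB.trans (closedBall_subset_closedBall hr₁)
  have hc : 0 < c₀ := by linarith
  refine ⟨hQc.measurableSet.diff isOpen_interior.measurableSet, ?_, r, hr, ?_, ?_⟩
  · have : frontier (Q₁ \ interior Q₂) ⊆ frontier Q₁ ∪ frontier Q₂ := by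
      rw [sdiff_eq]
      refine (frontier_inter_subset _ _).trans (union_subset_union inter_subset_left
        (inter_subset_right.trans ?_))
      rw [frontier_compl]
      exact frontier_interior_subset
    exact measure_mono_null this
      (measure_union_null (hQconv.addHaar_frontier volume) (hconv₂.addHaar_frontier volume))
  · intro h
    rw [mul_min_of_nonneg _ _ (by positivity), ENNReal.ofReal_min]
    refine le_min ?_ ?_
    · have h1 : shiftDiff (Q₁ \ interior Q₂) h ⊆ shiftDiff Q₁ h ∪ shiftDiff (interior Q₂) h := by
        intro x hx
        simp only [shiftDiff, mem_ofPred_eq, mem_sdiff, mem_union] at hx ⊢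
        tauto
      have h2 := volume_shiftDiff_le hQconv hr (by positivity) (ball_subset_closedBall.trans hbQ)
        hQB' h
      have h3 : volume (shiftDiff (interior Q₂) h) ≤
          ENNReal.ofReal (8 * Real.pi * c₀ ^ 3 * (‖h‖ * r)) := by
        rcases hQ₂ with rfl | ⟨-, -, -, -, -, y₁, y₂, s₁, s, hs, hbQ₂, hQB₂, hs₁⟩
        · simp [shiftDiff]
        refine (volume_shiftDiff_le hconv₂.interior hs (by positivity : 0 ≤ c₀ * s)
          (interior_maximal (ball_subset_closedBall.trans hbQ₂) isOpen_ball)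
          (interior_subset.trans (hQB₂.trans (closedBall_subset_closedBall hs₁))) h).trans
          (ENNReal.ofReal_le_ofReal ?_)
        have hsr : s ≤ c₀ * r := by
          have hball := hbQ₂.trans (hsub.trans hQB')
          set e : Plane := EuclideanSpace.single 0 1
          have he : ‖s • e‖ = s := by simp [e, norm_smul, abs_of_pos hs]
          have h₁ : dist (y₂ + s • e) x₁ ≤ c₀ * r := hball (by simp [he])
          have h₂ : dist (y₂ - s • e) x₁ ≤ c₀ * r := hball (by simp [he])
          have h₃ : dist (y₂ + s • e) (y₂ - s • e) = 2 * s := by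
            rw [dist_eq_norm, show y₂ + s • e - (y₂ - s • e) = (2 : ℝ) • s • e by module, norm_smul,
              he]
            norm_num
          linarith [dist_triangle_right (y₂ + s • e) (y₂ - s • e) x₁]
        calc 8 * Real.pi * (c₀ * s) ^ 2 * ‖h‖ / s = 8 * Real.pi * c₀ ^ 2 * ‖h‖ * s := by
              field_simp
          _ ≤ 8 * Real.pi * c₀ ^ 2 * ‖h‖ * (c₀ * r) := by gcongr
          _ = _ := by ring
      refine (measure_mono h1).trans ((measure_union_le _ _).trans ((add_le_add h2 h3).trans ?_))
      rw [← ENNReal.ofReal_add (by positivity) (by positivity)]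
      refine ENNReal.ofReal_le_ofReal ?_
      calc 8 * Real.pi * (c₀ * r) ^ 2 * ‖h‖ / r + 8 * Real.pi * c₀ ^ 3 * (‖h‖ * r)
          = 8 * Real.pi * c₀ ^ 2 * 1 * (‖h‖ * r) + 8 * Real.pi * c₀ ^ 3 * (‖h‖ * r) := by
            field_simp
        _ ≤ 8 * Real.pi * c₀ ^ 2 * c₀ * (‖h‖ * r) + 8 * Real.pi * c₀ ^ 3 * (‖h‖ * r) := by gcongr
        _ = _ := by ring
    · refine (volume_shiftDiff_le_two_mul _ _).trans ?_
      have : volume (Q₁ \ interior Q₂) ≤ ENNReal.ofReal (Real.pi * (c₀ * r) ^ 2) :=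
        volume_le_of_subset_closedBall (by positivity) (sdiff_subset.trans hQB')
      refine (mul_le_mul_right this 2).trans ?_
      rw [← ENNReal.ofReal_ofNat, ← ENNReal.ofReal_mul (by norm_num)]
      refine ENNReal.ofReal_le_ofReal ?_
      have : c₀ ^ 2 ≤ c₀ ^ 3 := pow_le_pow_right₀ hc₀ (by norm_num)
      nlinarith [mul_nonneg (mul_nonneg Real.pi_pos.le (sq_nonneg r)) (sub_nonneg.mpr this),
        mul_nonneg (mul_nonneg Real.pi_pos.le (sq_nonneg r)) (sq_nonneg c₀)]
  · have hsum := two_mul_le_sum_dist_of_frontier hbQ hQB v w hfr.subset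
    obtain ⟨i, hi⟩ : ∃ i, 2 * r / (N₀ + 1) < dist (v i) (w i) := by
      by_contra! hcon
      have h1 : ∑ i, dist (v i) (w i) ≤ m * (2 * r / (N₀ + 1)) := by
        refine (Finset.sum_le_sum fun i _ => hcon i).trans (le_of_eq ?_)
        simp
      have hm' : (m : ℝ) ≤ N₀ := by exact_mod_cast hm
      have h2 : m * (2 * r / (N₀ + 1)) < 2 * r := by
        rw [mul_div_assoc', div_lt_iff₀ (by positivity)]
        nlinarith
      linarith
    have hpos : 0 < 2 * r / (N₀ + 1) := by positivity
    obtain ⟨j, hj⟩ := exists_segment_subset_of_maximal hfrR hmax (dist_pos.mp (hpos.trans hi))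
      (((subset_iUnion (fun i => segment ℝ (v i) (w i)) i).trans hfr.superset).trans
        (frontier_subset_frontier_diff_interior hQc.isClosed hsub))
    obtain ⟨p, hp, ht₁, ht₂⟩ := htri j
    have hlen : dist (v i) (w i) ≤ dist (a j) (b j) := by
      have hv := hj (left_mem_segment ℝ (v i) (w i))
      have hw := hj (right_mem_segment ℝ (v i) (w i))
      rw [segment_eq_image_lineMap] at hv hw
      obtain ⟨x, hx, hxv⟩ := hv
      obtain ⟨y, hy, hyw⟩ := hw
      rw [← hxv, ← hyw, dist_lineMap_lineMap]
      exact mul_le_of_le_one_left dist_nonneg (Real.dist_le_of_mem_Icc_01 hx hy)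
    have hadd := dist_add_dist_of_mem_segment hp
    have hmono {y z : Plane} (hyz : r / (N₀ + 1) ≤ dist y z)
        (ht : HasGoodTriangle β (Q₁ \ interior Q₂) y z) :
        ENNReal.ofReal (r ^ 2 * (Real.sin β / (2 * (N₀ + 1) ^ 2))) * volume stdTriangle
          ≤ volume (Q₁ \ interior Q₂) := by
      refine le_trans (mul_le_mul_left (ENNReal.ofReal_le_ofReal ?_) _)
        (volume_ge_of_hasGoodTriangle hβ hβ' ht)
      have hsin : 0 ≤ Real.sin β :=
        Real.sin_nonneg_of_nonneg_of_le_pi hβ.le (by linarith [Real.pi_pos])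
      calc r ^ 2 * (Real.sin β / (2 * (N₀ + 1) ^ 2)) = (r / (N₀ + 1)) ^ 2 * Real.sin β / 2 := by
            field_simp
        _ ≤ _ := by gcongr
    have htwo : 2 * r / (N₀ + 1) = r / (N₀ + 1) + r / (N₀ + 1) := by ring
    rcases le_or_gt (r / (N₀ + 1)) (dist (a j) p) with h | h
    · exact hmono h ht₁
    · exact hmono (by linarith) ht₂

lemma lintegral_rpow_mul_min_le {α r : ℝ} (hα : 0 < α) (hα1 : α < 1) (hr : 0 < r) :
    ∫⁻ t in Ioi (0 : ℝ), ENNReal.ofReal (t ^ (-α - 1) * min (t * r) (r ^ 2)) ≤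
      ENNReal.ofReal ((1 / (1 - α) + 1 / α) * r ^ (2 - α)) := by
  have hpow : r ^ (1 - α) * r = r ^ (2 - α) := by
    rw [← Real.rpow_add_one hr.ne']; congr 1; ring
  have hpow' : r ^ (-α) * r ^ 2 = r ^ (2 - α) := by
    rw [← Real.rpow_natCast, ← Real.rpow_add hr]; congr 1; push_cast; ring
  have h1 : ∫⁻ t in Ioc 0 r, ENNReal.ofReal (t ^ (-α - 1) * min (t * r) (r ^ 2)) ≤
      ENNReal.ofReal (1 / (1 - α) * r ^ (2 - α)) := by
    have hint : IntegrableOn (fun t : ℝ => t ^ (-α) * r) (Ioc 0 r) :=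
      ((intervalIntegrable_iff_integrableOn_Ioc_of_le hr.le).mp
        (intervalIntegral.intervalIntegrable_rpow' (by linarith))).mul_const r
    calc ∫⁻ t in Ioc 0 r, ENNReal.ofReal (t ^ (-α - 1) * min (t * r) (r ^ 2))
        ≤ ∫⁻ t in Ioc 0 r, ENNReal.ofReal (t ^ (-α) * r) := by
          refine setLIntegral_mono' measurableSet_Ioc fun t ht => ENNReal.ofReal_le_ofReal ?_
          calc t ^ (-α - 1) * min (t * r) (r ^ 2) ≤ t ^ (-α - 1) * (t * r) := by
                gcongr
                · exact Real.rpow_nonneg ht.1.le _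
                · exact min_le_left _ _
            _ = t ^ (-α) * r := by
                rw [Real.rpow_sub_one ht.1.ne']; field_simp [ht.1.ne']
      _ = ENNReal.ofReal (∫ t in Ioc 0 r, t ^ (-α) * r) := by
          refine (ofReal_integral_eq_lintegral_ofReal hint ?_).symm
          filter_upwards [ae_restrict_mem measurableSet_Ioc] with t ht
          exact mul_nonneg (Real.rpow_nonneg ht.1.le _) hr.le
      _ = ENNReal.ofReal (1 / (1 - α) * r ^ (2 - α)) := by
          rw [integral_mul_const, ← intervalIntegral.integral_of_le hr.le,
            integral_rpow (Or.inl (by linarith)), Real.zero_rpow (by linarith), ← hpow]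
          congr 1
          rw [show -α + 1 = 1 - α by ring]; ring
  have h2 : ∫⁻ t in Ioi r, ENNReal.ofReal (t ^ (-α - 1) * min (t * r) (r ^ 2)) ≤
      ENNReal.ofReal (1 / α * r ^ (2 - α)) := by
    have hint : IntegrableOn (fun t : ℝ => t ^ (-α - 1) * r ^ 2) (Ioi r) :=
      (integrableOn_Ioi_rpow_of_lt (by linarith) hr).mul_const _
    calc ∫⁻ t in Ioi r, ENNReal.ofReal (t ^ (-α - 1) * min (t * r) (r ^ 2))
        ≤ ∫⁻ t in Ioi r, ENNReal.ofReal (t ^ (-α - 1) * r ^ 2) := by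
          refine setLIntegral_mono' measurableSet_Ioi fun t ht => ENNReal.ofReal_le_ofReal ?_
          gcongr
          · exact Real.rpow_nonneg (hr.le.trans (mem_Ioi.mp ht).le) _
          · exact min_le_right _ _
      _ = ENNReal.ofReal (∫ t in Ioi r, t ^ (-α - 1) * r ^ 2) := by
          refine (ofReal_integral_eq_lintegral_ofReal hint ?_).symm
          filter_upwards [ae_restrict_mem measurableSet_Ioi] with t ht
          exact mul_nonneg (Real.rpow_nonneg (hr.le.trans (mem_Ioi.mp ht).le) _) (sq_nonneg r)
      _ = ENNReal.ofReal (1 / α * r ^ (2 - α)) := by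
          rw [integral_mul_const, integral_Ioi_rpow_of_lt (by linarith) hr, ← hpow',
            sub_add_cancel]
          congr 1
          field_simp
  rw [← Ioc_union_Ioi_eq_Ioi hr.le]
  refine (lintegral_union_le _ _ _).trans ((add_le_add h1 h2).trans (le_of_eq ?_))
  have : 0 < 1 - α := by linarith
  rw [← ENNReal.ofReal_add (by positivity) (by positivity), add_mul]

/-- A sum with at most two nonzero terms. -/
lemma enorm_sum_rpow_le_of_card_le_two {ι : Type*} (J : Finset ι) (hJ : J.card ≤ 2)
    (g : ι → ℝ) {τ : ℝ} (hτ : 0 < τ) :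
    ‖∑ j ∈ J, g j‖ₑ ^ τ ≤ ∑ j ∈ J, (2 * ‖g j‖ₑ) ^ τ := by
  rcases J.eq_empty_or_nonempty with rfl | hne
  · simp [hτ]
  obtain ⟨k, hk, hmax⟩ := J.exists_max_image (fun j => ‖g j‖ₑ) hne
  have h1 : ‖∑ j ∈ J, g j‖ₑ ≤ 2 * ‖g k‖ₑ := by
    refine (enorm_sum_le J g).trans ((Finset.sum_le_card_nsmul J _ _ hmax).trans ?_)
    rw [nsmul_eq_mul]
    gcongr
    exact_mod_cast hJ
  exact (ENNReal.rpow_le_rpow h1 hτ.le).trans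
    (Finset.single_le_sum (f := fun j => (2 * ‖g j‖ₑ) ^ τ) (fun _ _ => zero_le) hk)

section PiecewiseConstant

variable {n : ℕ} {R : Fin n → Set Plane} {f : Plane → ℝ} {c : Fin n → ℝ}

lemma ae_notMem_frontier (hnull : ∀ j, volume (frontier (R j)) = 0) :
    ∀ᵐ x : Plane, ∀ j, x ∉ frontier (R j) :=
  ae_all_iff.mpr fun j => measure_eq_zero_iff_ae_notMem.mp (hnull j)

lemma eq_of_mem_of_notMem_frontier (hdisj : ∀ i j, i ≠ j → interior (R i) ∩ interior (R j) = ∅)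
    {x : Plane} (hx : ∀ j, x ∉ frontier (R j)) {i j : Fin n} (hi : x ∈ R i) (hj : x ∈ R j) :
    i = j := by
  have hint (k : Fin n) (hk : x ∈ R k) : x ∈ interior (R k) := by
    by_contra h
    exact hx k ⟨subset_closure hk, h⟩
  by_contra hij
  exact (hdisj i j hij).subset ⟨hint i hi, hint j hj⟩

lemma lintegral_enorm_shift_sub_rpow_le (hR : ∀ j, MeasurableSet (R j))
    (hdisj : ∀ i j, i ≠ j → interior (R i) ∩ interior (R j) = ∅)
    (hnull : ∀ j, volume (frontier (R j)) = 0)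
    (hf : f = fun x => ∑ j, (R j).indicator (fun _ => c j) x) {τ : ℝ} (hτ : 0 < τ) (h : Plane) :
    ∫⁻ x, ‖f (x + h) - f x‖ₑ ^ τ ≤ ∑ j, (2 * ‖c j‖ₑ) ^ τ * volume (shiftDiff (R j) h) := by
  have hae := ae_notMem_frontier hnull
  have hae' := (measurePreserving_add_right volume h).quasiMeasurePreserving.ae hae
  calc ∫⁻ x, ‖f (x + h) - f x‖ₑ ^ τ
      ≤ ∫⁻ x, ∑ j, (shiftDiff (R j) h).indicator (fun _ => (2 * ‖c j‖ₑ) ^ τ) x := by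
        refine lintegral_mono_ae ?_
        filter_upwards [hae, hae'] with x hx hx'
        set g : Fin n → ℝ := fun j =>
          (R j).indicator (fun _ => c j) (x + h) - (R j).indicator (fun _ => c j) x with hg
        set J : Finset (Fin n) := Finset.univ.filter fun j => x ∈ shiftDiff (R j) h with hJ
        have hmemJ (j) : j ∈ J ↔ ¬ (x ∈ R j ↔ x + h ∈ R j) :=
          Finset.mem_filter.trans (and_iff_right (Finset.mem_univ j))
        have hgJ (j) (hj : j ∉ J) : g j = 0 := by
          rw [hmemJ, not_not] at hj
          by_cases hxj : x ∈ R j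
          · simp [hg, hxj, hj.mp hxj]
          · simp [hg, hxj, mt hj.mpr hxj]
        have hgJ' (j) (hj : j ∈ J) : ‖g j‖ₑ = ‖c j‖ₑ := by
          rw [hmemJ] at hj
          by_cases hxj : x ∈ R j
          · have : x + h ∉ R j := fun h' => hj (by tauto)
            simp [hg, hxj, this]
          · have : x + h ∈ R j := by by_contra h'; exact hj (by tauto)
            simp [hg, hxj, this]
        have hsum : f (x + h) - f x = ∑ j ∈ J, g j := by
          rw [hf, ← Finset.sum_sub_distrib]
          exact (Finset.sum_subset (Finset.subset_univ J) fun j _ hj => hgJ j hj).symm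
        have hcard : J.card ≤ 2 := by
          have hsub : J ⊆ (Finset.univ.filter fun j => x ∈ R j) ∪
              (Finset.univ.filter fun j => x + h ∈ R j) := by
            intro j hj
            rw [hmemJ] at hj
            simp only [Finset.mem_filter, Finset.mem_univ, true_and, Finset.mem_union]
            tauto
          refine (Finset.card_le_card hsub).trans ((Finset.card_union_le _ _).trans
            (add_le_add (a := _) (b := 1) (c := _) (d := 1) ?_ ?_)) <;>
            refine Finset.card_le_one.mpr fun i hi j hj => ?_
          · exact eq_of_mem_of_notMem_frontier hdisj hx (Finset.mem_filter.mp hi).2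
              (Finset.mem_filter.mp hj).2
          · exact eq_of_mem_of_notMem_frontier hdisj hx' (Finset.mem_filter.mp hi).2
              (Finset.mem_filter.mp hj).2
        rw [hsum]
        refine (enorm_sum_rpow_le_of_card_le_two J hcard g hτ).trans (le_of_eq ?_)
        rw [hJ, Finset.sum_filter]
        refine Finset.sum_congr rfl fun j _ => ?_
        by_cases hj : x ∈ shiftDiff (R j) h
        · rw [if_pos hj, indicator_of_mem hj, hgJ' j (by simp [hJ, hj])]
        · rw [if_neg hj, indicator_of_notMem hj]
    _ = ∑ j, (2 * ‖c j‖ₑ) ^ τ * volume (shiftDiff (R j) h) := by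
        rw [lintegral_finsetSum _ fun j _ =>
          measurable_const.indicator (measurableSet_shiftDiff (hR j) h)]
        simp only [lintegral_indicator_const (measurableSet_shiftDiff (hR _) h)]

lemma sum_enorm_rpow_mul_volume_le
    (hdisj : ∀ i j, i ≠ j → interior (R i) ∩ interior (R j) = ∅)
    (hnull : ∀ j, volume (frontier (R j)) = 0)
    (hf : f = fun x => ∑ j, (R j).indicator (fun _ => c j) x) {Ω : Set Plane}
    (hΩ : ∀ j, R j ⊆ Ω) (p : ℝ) :
    ∑ j, ‖c j‖ₑ ^ p * volume (R j) ≤ ∫⁻ x in Ω, ‖f x‖ₑ ^ p := by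
  have hint (j : Fin n) : ∫⁻ x in interior (R j), ‖f x‖ₑ ^ p = ‖c j‖ₑ ^ p * volume (R j) := by
    rw [← measure_congr (interior_ae_eq_of_null_frontier (hnull j)), ← setLIntegral_const]
    refine setLIntegral_congr_fun_ae isOpen_interior.measurableSet ?_
    filter_upwards [ae_notMem_frontier hnull] with x hx hxj
    have : f x = c j := by
      rw [hf]
      simp only
      rw [Finset.sum_eq_single j, indicator_of_mem (interior_subset hxj)]
      · intro i _ hij
        exact indicator_of_notMem
          (fun hi => hij (eq_of_mem_of_notMem_frontier hdisj hx hi (interior_subset hxj))) _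
      · simp
    rw [this]
  rw [← Finset.sum_congr rfl fun j _ => hint j, ← tsum_fintype (L := .unconditional _),
    ← lintegral_iUnion (fun j => isOpen_interior.measurableSet)
      fun i j hij => disjoint_iff_inter_eq_empty.mpr (hdisj i j hij)]
  exact lintegral_mono_set (iUnion_subset fun j => interior_subset.trans (hΩ j))

end PiecewiseConstant

lemma besovSeminorm_rpow_le {n : ℕ} {R : Fin n → Set Plane} {f : Plane → ℝ} {c : Fin n → ℝ}
    (hR : ∀ j, MeasurableSet (R j))
    (hdisj : ∀ i j, i ≠ j → interior (R i) ∩ interior (R j) = ∅)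
    (hnull : ∀ j, volume (frontier (R j)) = 0)
    (hf : f = fun x => ∑ j, (R j).indicator (fun _ => c j) x) (Ω : Set Plane)
    {r : Fin n → ℝ} (hr : ∀ j, 0 < r j) {C s τ : ℝ} (hC : 0 ≤ C) (hs : 0 < s) (hτ : 0 < τ)
    (hsτ : s * τ < 1)
    (hshift : ∀ j h, volume (shiftDiff (R j) h) ≤
      ENNReal.ofReal (C * min (‖h‖ * r j) (r j ^ 2))) :
    besovSeminorm Ω 1 s τ f ^ τ ≤
      ENNReal.ofReal (C * (1 / (1 - s * τ) + 1 / (s * τ))) *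
        ∑ j, (2 * ‖c j‖ₑ) ^ τ * ENNReal.ofReal (r j ^ (2 - s * τ)) := by
  have hα : 0 < s * τ := mul_pos hs hτ
  have hα' : 0 < 1 - s * τ := by linarith
  have hnorm (t : ℝ) : modulus Ω 1 τ f t ^ τ ≤
      ∑ j, (2 * ‖c j‖ₑ) ^ τ * ENNReal.ofReal (C * min (t * r j) (r j ^ 2)) := by
    rw [← ENNReal.le_rpow_inv_iff hτ]
    refine iSup₂_le fun h ht => ?_
    rw [lpNormE, eLpNorm_eq_lintegral_rpow_enorm_toReal (by simpa using hτ) ENNReal.ofReal_ne_top,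
      ENNReal.toReal_ofReal hτ.le, one_div]
    refine ENNReal.rpow_le_rpow ?_ (by positivity)
    calc ∫⁻ x in Ω, ‖deltah Ω 1 h f x‖ₑ ^ τ
        ≤ ∫⁻ x, ‖deltah Ω 1 h f x‖ₑ ^ τ := setLIntegral_le_lintegral _ _
      _ ≤ ∫⁻ x, ‖f (x + h) - f x‖ₑ ^ τ := by
          refine lintegral_mono fun x => ENNReal.rpow_le_rpow ?_ hτ.le
          rw [deltah]
          split_ifs
          · refine le_of_eq (congrArg _ ?_)
            simp [Finset.sum_range_succ, pow_succ]
            ring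
          · simp
      _ ≤ _ := lintegral_enorm_shift_sub_rpow_le hR hdisj hnull hf hτ h
      _ ≤ _ := by
          refine Finset.sum_le_sum fun j _ => mul_le_mul_right
            ((hshift j h).trans (ENNReal.ofReal_le_ofReal ?_)) _
          have := (hr j).le
          gcongr
  rw [besovSeminorm, ← ENNReal.rpow_mul, one_div_mul_cancel hτ.ne', ENNReal.rpow_one]
  calc ∫⁻ t in Ioi (0 : ℝ), (ENNReal.ofReal (t ^ (-s)) * modulus Ω 1 τ f t) ^ τ / ENNReal.ofReal t
      ≤ ∫⁻ t in Ioi (0 : ℝ), ∑ j, (2 * ‖c j‖ₑ) ^ τ * ENNReal.ofReal C *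
          ENNReal.ofReal (t ^ (-(s * τ) - 1) * min (t * r j) (r j ^ 2)) := by
        refine setLIntegral_mono' measurableSet_Ioi fun t ht => ?_
        have ht : 0 < t := ht
        have hpow : ENNReal.ofReal (t ^ (-s)) ^ τ / ENNReal.ofReal t =
            ENNReal.ofReal (t ^ (-(s * τ) - 1)) := by
          rw [ENNReal.ofReal_rpow_of_nonneg (by positivity) hτ.le, ← ENNReal.ofReal_div_of_pos ht,
            ← Real.rpow_mul ht.le, Real.rpow_sub_one ht.ne', neg_mul]
        rw [ENNReal.mul_rpow_of_nonneg _ _ hτ.le, ENNReal.mul_div_right_comm, hpow]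
        refine (mul_le_mul_right (hnorm t) _).trans (le_of_eq ?_)
        rw [Finset.mul_sum]
        refine Finset.sum_congr rfl fun j _ => ?_
        rw [ENNReal.ofReal_mul hC, ENNReal.ofReal_mul (by positivity)]
        ring
    _ = ∑ j, (2 * ‖c j‖ₑ) ^ τ * ENNReal.ofReal C * ∫⁻ t in Ioi (0 : ℝ),
          ENNReal.ofReal (t ^ (-(s * τ) - 1) * min (t * r j) (r j ^ 2)) := by
        rw [lintegral_finsetSum _ fun j _ => by fun_prop]
        exact Finset.sum_congr rfl fun j _ => lintegral_const_mul _ (by fun_prop)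
    _ ≤ ∑ j, (2 * ‖c j‖ₑ) ^ τ * ENNReal.ofReal C *
          ENNReal.ofReal ((1 / (1 - s * τ) + 1 / (s * τ)) * r j ^ (2 - s * τ)) :=
        Finset.sum_le_sum fun j _ => mul_le_mul_right (lintegral_rpow_mul_min_le hα hsτ (hr j)) _
    _ = _ := by
        rw [Finset.mul_sum]
        refine Finset.sum_congr rfl fun j _ => ?_
        rw [ENNReal.ofReal_mul (by positivity), ENNReal.ofReal_mul hC]
        ring

/-- Hölder's inequality for the weighted coefficient sums. -/
lemma sum_enorm_rpow_le_card_mul {n : ℕ} (c r : Fin n → ℝ) (hr : ∀ j, 0 < r j) {p s τ : ℝ}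
    (hp : 0 < p) (hs : 0 < s) (hτ0 : 0 < τ) (hτ : 1 / τ = s / 2 + 1 / p) :
    (∑ j, (2 * ‖c j‖ₑ) ^ τ * ENNReal.ofReal (r j ^ (2 - s * τ))) ^ (1 / τ) ≤
      2 * (n : ℝ≥0∞) ^ (s / 2) * (∑ j, ‖c j‖ₑ ^ p * ENNReal.ofReal (r j ^ 2)) ^ (1 / p) := by
  have hrel : s * τ * p + 2 * τ = 2 * p := by
    field_simp at hτ
    linarith
  have hτp : τ ≤ p := by nlinarith [mul_pos (mul_pos hs hτ0) hp]
  have hterm (j : Fin n) : (2 * ‖c j‖ₑ) ^ τ * ENNReal.ofReal (r j ^ (2 - s * τ)) =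
      2 ^ τ * (‖c j‖ₑ ^ p * ENNReal.ofReal (r j ^ 2)) ^ (τ / p) := by
    rw [ENNReal.mul_rpow_of_nonneg _ _ hτ0.le, ENNReal.mul_rpow_of_nonneg _ _ (by positivity),
      ← ENNReal.rpow_mul, mul_div_cancel₀ _ hp.ne',
      ENNReal.ofReal_rpow_of_nonneg (by positivity) (by positivity), ← Real.rpow_natCast,
      ← Real.rpow_mul (hr j).le, mul_assoc]
    congr 4
    field_simp
    push_cast
    linarith
  simp only [hterm]
  rw [← Finset.mul_sum, ENNReal.mul_rpow_of_nonneg _ _ (by positivity), ← ENNReal.rpow_mul,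
    mul_one_div_cancel hτ0.ne', ENNReal.rpow_one, mul_assoc]
  refine mul_le_mul_right ?_ _
  set M : Fin n → ℝ≥0∞ := fun j => ‖c j‖ₑ ^ p * ENNReal.ofReal (r j ^ 2)
  have hholder := ENNReal.rpow_sum_le_const_mul_sum_rpow Finset.univ (fun j => M j ^ (τ / p))
    ((one_le_div hτ0).mpr hτp)
  have hM (j) : (M j ^ (τ / p)) ^ (p / τ) = M j := by
    rw [← ENNReal.rpow_mul, div_mul_div_cancel₀ hp.ne', div_self hτ0.ne', ENNReal.rpow_one]
  simp only [hM, Finset.card_univ, Fintype.card_fin] at hholder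
  calc (∑ j, M j ^ (τ / p)) ^ (1 / τ) = ((∑ j, M j ^ (τ / p)) ^ (p / τ)) ^ (1 / p) := by
        rw [← ENNReal.rpow_mul]; congr 1; field_simp
    _ ≤ ((n : ℝ≥0∞) ^ (p / τ - 1) * ∑ j, M j) ^ (1 / p) :=
        ENNReal.rpow_le_rpow hholder (by positivity)
    _ = _ := by
        rw [ENNReal.mul_rpow_of_nonneg _ _ (by positivity), ← ENNReal.rpow_mul]
        congr 2
        rw [sub_mul, div_mul_div_cancel₀' hp.ne', hτ]
        ring

lemma IsSpline.exists_eq_sum_indicator {N₀ : ℕ} {c₀ β : ℝ} {n : ℕ} {Ω : Set Plane} {S : Plane → ℝ}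
    (hS : IsSpline N₀ c₀ β n 1 Ω S) :
    ∃ (R : Fin n → Set Plane) (c : Fin n → ℝ), (∀ j, IsRing N₀ c₀ β (R j)) ∧
      (∀ i j, i ≠ j → interior (R i) ∩ interior (R j) = ∅) ∧ (∀ j, R j ⊆ Ω) ∧
      S = fun x => ∑ j, (R j).indicator (fun _ => c j) x := by
  obtain ⟨R, P, hR, hdisj, hcover, hdeg, hS, -⟩ := hS
  refine ⟨R, fun j => (P j).coeff 0, hR, hdisj, fun j => ?_, ?_⟩
  · rcases hcover with rfl | ⟨rfl, -⟩
    · exact subset_iUnion R j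
    · exact subset_univ _
  · have hP (j) : P j = MvPolynomial.C ((P j).coeff 0) :=
      MvPolynomial.totalDegree_eq_zero_iff_eq_C.mp (by have := hdeg j; omega)
    rw [hS]
    funext x
    refine Finset.sum_congr rfl fun j _ => ?_
    conv_lhs => rw [hP j]
    simp only [MvPolynomial.eval_C]

/-- **Bernstein estimate for piecewise constants.** -/
theorem bernstein_piecewise_constants (N₀ : ℕ) (c₀ β : ℝ) (hc₀ : 1 ≤ c₀) (hβ : 0 < β) (hβ' : β ≤ Real.pi / 3)
    (p s τ : ℝ) (hp : 0 < p) (hs : 0 < s) (hs2 : s < 2 / p) (hτ : 1 / τ = s / 2 + 1 / p) :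
    ∃ c : ℝ, 0 < c ∧
      ∀ (Ω : Set Plane) (n₀ : ℕ), IsCompact Ω → IsRingDecomp N₀ c₀ β n₀ Ω →
        ∀ n : ℕ, n₀ ≤ n → ∀ S : Plane → ℝ, IsSpline N₀ c₀ β n 1 Ω S →
          besovSeminorm Ω 1 s τ S ≤
            ENNReal.ofReal (c * (n : ℝ) ^ (s / 2)) * lpNormE p Ω S := by
  have hτinv : 0 < 1 / τ := by rw [hτ]; positivity
  have hτ0 : 0 < τ := one_div_pos.mp hτinv
  have hsτ : s * τ < 1 := by
    have : s < 1 / τ := by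
      rw [hτ]
      rw [show 2 / p = 2 * (1 / p) by ring] at hs2
      linarith
    rwa [lt_div_iff₀ hτ0] at this
  set K : ℝ≥0∞ :=
    ENNReal.ofReal (16 * Real.pi * c₀ ^ 3 * (1 / (1 - s * τ) + 1 / (s * τ))) with hK
  set κ : ℝ≥0∞ :=
    ENNReal.ofReal (Real.sin β / (2 * (N₀ + 1) ^ 2)) * volume stdTriangle with hκ
  have hκ0 : κ ≠ 0 := by
    have hsin : 0 < Real.sin β := Real.sin_pos_of_pos_of_lt_pi hβ (by linarith [Real.pi_pos])
    exact mul_ne_zero (ENNReal.ofReal_pos.mpr (by positivity)).ne' volume_stdTriangle_pos.ne'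
  have hκtop : κ ≠ ∞ := ENNReal.mul_ne_top ENNReal.ofReal_ne_top volume_stdTriangle_ne_top
  set D : ℝ≥0∞ := K ^ (1 / τ) * 2 * (κ⁻¹) ^ (1 / p) with hD
  have hDtop : D ≠ ∞ :=
    ENNReal.mul_ne_top (ENNReal.mul_ne_top
      (ENNReal.rpow_ne_top_of_nonneg hτinv.le ENNReal.ofReal_ne_top) ENNReal.ofNat_ne_top)
      (ENNReal.rpow_ne_top_of_nonneg (by positivity) (ENNReal.inv_ne_top.mpr hκ0))
  refine ⟨D.toReal + 1, by positivity, fun Ω n₀ _ _ n _ S hS => ?_⟩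
  obtain ⟨R, c, hR, hdisj, hRΩ, hSeq⟩ := hS.exists_eq_sum_indicator
  choose hmeas hnull r hr hshift hvol using fun j => (hR j).exists_radius hc₀ hβ hβ'
  have hc₀' : 0 < c₀ := by linarith
  have hbesov := besovSeminorm_rpow_le hmeas hdisj hnull hSeq Ω hr (by positivity) hs hτ0 hsτ hshift
  have hweights : ∑ j, ‖c j‖ₑ ^ p * ENNReal.ofReal (r j ^ 2) ≤ κ⁻¹ * ∫⁻ x in Ω, ‖S x‖ₑ ^ p := by
    refine le_trans ?_ (mul_le_mul_right (sum_enorm_rpow_mul_volume_le hdisj hnull hSeq hRΩ p) _)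
    rw [Finset.mul_sum]
    refine Finset.sum_le_sum fun j _ => ?_
    rw [mul_left_comm]
    refine mul_le_mul_right ?_ _
    rw [← mul_comm (volume (R j)), ← div_eq_mul_inv,
      ENNReal.le_div_iff_mul_le (Or.inl hκ0) (Or.inl hκtop), hκ, ← mul_assoc,
      ← ENNReal.ofReal_mul (sq_nonneg _)]
    exact hvol j
  have hlp : lpNormE p Ω S = (∫⁻ x in Ω, ‖S x‖ₑ ^ p) ^ (1 / p) := by
    rw [lpNormE, eLpNorm_eq_lintegral_rpow_enorm_toReal (by simpa using hp) ENNReal.ofReal_ne_top,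
      ENNReal.toReal_ofReal hp.le]
  calc besovSeminorm Ω 1 s τ S = (besovSeminorm Ω 1 s τ S ^ τ) ^ (1 / τ) := by
        rw [← ENNReal.rpow_mul, mul_one_div_cancel hτ0.ne', ENNReal.rpow_one]
    _ ≤ (K * ∑ j, (2 * ‖c j‖ₑ) ^ τ * ENNReal.ofReal (r j ^ (2 - s * τ))) ^ (1 / τ) :=
        ENNReal.rpow_le_rpow hbesov hτinv.le
    _ ≤ K ^ (1 / τ) * (2 * (n : ℝ≥0∞) ^ (s / 2) *
          (κ⁻¹ * ∫⁻ x in Ω, ‖S x‖ₑ ^ p) ^ (1 / p)) := by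
        rw [ENNReal.mul_rpow_of_nonneg _ _ hτinv.le]
        refine mul_le_mul_right ((sum_enorm_rpow_le_card_mul c r hr hp hs hτ0 hτ).trans ?_) _
        exact mul_le_mul_right (ENNReal.rpow_le_rpow hweights (by positivity)) _
    _ = D * (n : ℝ≥0∞) ^ (s / 2) * lpNormE p Ω S := by
        rw [ENNReal.mul_rpow_of_nonneg _ _ (by positivity), hlp, hD]
        ring
    _ ≤ ENNReal.ofReal ((D.toReal + 1) * (n : ℝ) ^ (s / 2)) * lpNormE p Ω S := by
        refine mul_le_mul_left ?_ _
        rw [ENNReal.ofReal_mul (by positivity),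
          ← ENNReal.ofReal_rpow_of_nonneg n.cast_nonneg (by positivity), ENNReal.ofReal_natCast]
        refine mul_le_mul_left ?_ _
        rw [← ENNReal.ofReal_toReal hDtop, ENNReal.toReal_ofReal ENNReal.toReal_nonneg]
        exact ENNReal.ofReal_le_ofReal (by linarith)

end
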